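/- Let n ≥ 1 be odd and let P = (ξ_1 − ξ_2)(ξ_2 − ξ_3)⋯(ξ_{n−1} − ξ_n) ∈ 𝒞_n. The trace of the ℂ-linear endomorphism of 𝒞_n given by left multiplication by P equals (−1)^{(n−1)/2}·2^n (equivalently, the coefficient of 1 in the expansion of P in the standard monomial basis of 𝒞_n is (−1)^{(n−1)/2}). -/

import Mathlib

namespace CliffordSpin

open CliffordAlgebra

/-- The quadratic form `Q(x) = x₁² + ⋯ + xₙ²` on `ℂⁿ`. -/
noncomputable def Qf (n : ℕ) : QuadraticForm ℂ (Fin n → ℂ) :=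
  QuadraticMap.weightedSumSquares ℂ (fun _ : Fin n => (1 : ℂ))

/-- The Clifford algebra `𝒞ₙ`. -/
abbrev Cl (n : ℕ) := CliffordAlgebra (Qf n)

/-- The generators `ξᵢ` of `𝒞ₙ` (images of the standard basis vectors). -/
noncomputable def ξ (n : ℕ) (i : Fin n) : Cl n := CliffordAlgebra.ι (Qf n) (Pi.single i 1)

/-- The idempotents `eᵢ = (1/2)(1 + √−1 ξ_{2i−1} ξ_{2i})` and their product
`e = e₁ ⋯ e_r`, `r = ⌊n/2⌋` (indices are 0-based here). -/
noncomputable def eIdem (n : ℕ) : Cl n :=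
  ((List.finRange (n / 2)).map fun i : Fin (n / 2) =>
      (2 : ℂ)⁻¹ • (1 + Complex.I •
        (ξ n ⟨2 * (i : ℕ), by have := i.isLt; omega⟩ *
         ξ n ⟨2 * (i : ℕ) + 1, by have := i.isLt; omega⟩))).prod

/-- The left ideal `Lₙ = 𝒞ₙ·e`, as a ℂ-subspace of `𝒞ₙ`. -/
noncomputable def Ln (n : ℕ) : Submodule ℂ (Cl n) := LinearMap.range (LinearMap.mulRight ℂ (eIdem n))


/-- `P = (ξ₁ − ξ₂)(ξ₂ − ξ₃) ⋯ (ξ_{n−1} − ξₙ)` (0-based indexing). -/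
noncomputable def Pelt (n : ℕ) : Cl n :=
  ((List.finRange (n - 1)).map fun i : Fin (n - 1) =>
      ξ n ⟨(i : ℕ), by have := i.isLt; omega⟩ -
      ξ n ⟨(i : ℕ) + 1, by have := i.isLt; omega⟩).prod

theorem mul_list_prod_of_anticommute {A : Type*} [Ring A] (x : A) (l : List A)
    (h : ∀ y ∈ l, x * y = -(y * x)) : x * l.prod = (-1) ^ l.length * (l.prod * x) := by
  induction l with
  | nil => simp
  | cons y l ih =>
    have hy := h y (by simp)
    have hl := ih fun z hz => h z (by simp [hz])
    have hc : y * (-1) ^ l.length = (-1) ^ l.length * y :=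
      ((Commute.one_right y).neg_right.pow_right _).eq
    rw [List.prod_cons, List.length_cons, ← mul_assoc, hy, neg_mul, mul_assoc, hl, ← mul_assoc, hc,
      pow_succ]
    noncomm_ring

/-- A tracial functional on a product of an even number of elements for which consecutive
elements have anticommutator `-2` and all other pairs anticommute. -/
theorem tracial_prod_range' {R A : Type*} [Field R] [CharZero R] [Ring A] [Algebra R A]
    (τ : A →ₗ[R] R) (hτ : ∀ x y, τ (x * y) = τ (y * x)) (d : ℕ → A) (N : ℕ)
    (hadj : ∀ i, i + 1 < N → d i * d (i + 1) + d (i + 1) * d i = -2)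
    (hfar : ∀ i j, i + 2 ≤ j → j < N → d i * d j = -(d j * d i)) (m k : ℕ) (hk : k + 2 * m ≤ N) :
    τ ((List.range' k (2 * m)).map d).prod = (-1) ^ m * τ 1 := by
  induction m generalizing k with
  | zero => simp
  | succ m ih =>
    set w := ((List.range' (k + 2) (2 * m)).map d).prod with hw
    have hsplit : ((List.range' k (2 * (m + 1))).map d).prod = d k * (d (k + 1) * w) := by
      rw [show 2 * (m + 1) = 2 * m + 1 + 1 by ring, List.range'_succ, List.range'_succ]
      simp [hw]
    have hcomm : d k * w = w * d k := by
      have := mul_list_prod_of_anticommute (d k) ((List.range' (k + 2) (2 * m)).map d) (by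
        simp only [List.mem_map, List.mem_range'_1]
        rintro _ ⟨j, hj, rfl⟩
        exact hfar k j (by omega) (by omega))
      simpa using this
    have hmove : d k * (d (k + 1) * w) = (-2 : R) • w - d (k + 1) * w * d k := by
      rw [← mul_assoc, eq_sub_of_add_eq (hadj k (by omega)), sub_mul, mul_assoc, hcomm, mul_assoc]
      simp [two_mul, two_smul]
    have hrec : τ (d k * (d (k + 1) * w)) = -2 * τ w - τ (d k * (d (k + 1) * w)) := by
      conv_lhs => rw [hmove]
      rw [map_sub, map_smul, smul_eq_mul, hτ (d (k + 1) * w)]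
    have h2 : (2 : R) * τ (d k * (d (k + 1) * w)) = 2 * -τ w := by linear_combination hrec
    rw [hsplit, mul_left_cancel₀ two_ne_zero h2, ih (k + 2) (by omega), pow_succ]
    ring

theorem trace_mulLeft_mul_comm {R A : Type*} [CommRing R] [Ring A] [Algebra R A] (x y : A) :
    LinearMap.trace R A (LinearMap.mulLeft R (x * y)) =
      LinearMap.trace R A (LinearMap.mulLeft R (y * x)) := by
  simp only [LinearMap.mulLeft_mul]
  exact LinearMap.trace_mul_comm R _ _

theorem finrank_Cl (n : ℕ) : Module.finrank ℂ (Cl n) = 2 ^ n := by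
  rw [(CliffordAlgebra.equivExterior (Qf n)).finrank_eq,
    Module.finrank_eq_card_basis (Pi.basisFun ℂ (Fin n)).ExteriorAlgebra]
  simp

instance finite_Cl (n : ℕ) : Module.Finite ℂ (Cl n) :=
  have : Module.Finite ℂ (ExteriorAlgebra ℂ (Fin n → ℂ)) :=
    Module.Finite.of_basis (Pi.basisFun ℂ (Fin n)).ExteriorAlgebra
  Module.Finite.equiv (CliffordAlgebra.equivExterior (Qf n)).symm

theorem ξ_mul_self (n : ℕ) (i : Fin n) : ξ n i * ξ n i = 1 := by
  have hQ : Qf n (Pi.single i 1) = 1 := by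
    simp [Qf, QuadraticMap.weightedSumSquares_apply, Pi.single_apply]
  rw [ξ, CliffordAlgebra.ι_sq_scalar, hQ, map_one]

theorem ξ_mul_ξ_of_ne (n : ℕ) {i j : Fin n} (h : i ≠ j) : ξ n i * ξ n j = -(ξ n j * ξ n i) := by
  refine CliffordAlgebra.ι_mul_ι_comm_of_isOrtho ?_
  simp only [QuadraticMap.isOrtho_def, Qf, QuadraticMap.weightedSumSquares_apply,
    ← Finset.sum_add_distrib]
  refine Finset.sum_congr rfl fun l _ => ?_
  by_cases hi : l = i
  · subst hi
    simp [h]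
  · simp [hi]

/-- The difference `ξᵢ − ξᵢ₊₁`, extended by zero to all natural numbers. -/
noncomputable def ξdiff (n i : ℕ) : Cl n :=
  if h : i + 1 < n then ξ n ⟨i, by omega⟩ - ξ n ⟨i + 1, h⟩ else 0

theorem Pelt_eq (n : ℕ) : Pelt n = ((List.range' 0 (n - 1)).map (ξdiff n)).prod := by
  rw [← List.range_eq_range', ← List.map_coe_finRange_eq_range, List.map_map, Pelt]
  congr 1
  refine List.map_congr_left fun i _ => ?_
  have := i.isLt
  simp [ξdiff, show (i : ℕ) + 1 < n by omega]

theorem ξdiff_adjacent (n i : ℕ) (h : i + 1 < n - 1) :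
    ξdiff n i * ξdiff n (i + 1) + ξdiff n (i + 1) * ξdiff n i = -2 := by
  rw [ξdiff, ξdiff, dif_pos (by omega), dif_pos (by omega)]
  have h01 := ξ_mul_ξ_of_ne n (i := ⟨i, by omega⟩) (j := ⟨i + 1, by omega⟩) (by simp)
  have h02 := ξ_mul_ξ_of_ne n (i := ⟨i, by omega⟩) (j := ⟨i + 1 + 1, by omega⟩) (by simp; omega)
  have h12 := ξ_mul_ξ_of_ne n (i := ⟨i + 1, by omega⟩) (j := ⟨i + 1 + 1, by omega⟩) (by simp)
  have h11 := ξ_mul_self n ⟨i + 1, by omega⟩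
  simp only [sub_mul, mul_sub, h01, h02, h12, h11]
  rw [← one_add_one_eq_two]
  abel

theorem ξdiff_anticommute (n i j : ℕ) (hij : i + 2 ≤ j) (h : j < n - 1) :
    ξdiff n i * ξdiff n j = -(ξdiff n j * ξdiff n i) := by
  rw [ξdiff, ξdiff, dif_pos (by omega), dif_pos (by omega)]
  simp only [sub_mul, mul_sub]
  rw [ξ_mul_ξ_of_ne n (i := ⟨i, by omega⟩) (j := ⟨j, by omega⟩) (by simp; omega),
    ξ_mul_ξ_of_ne n (i := ⟨i, by omega⟩) (j := ⟨j + 1, by omega⟩) (by simp; omega),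
    ξ_mul_ξ_of_ne n (i := ⟨i + 1, by omega⟩) (j := ⟨j, by omega⟩) (by simp; omega),
    ξ_mul_ξ_of_ne n (i := ⟨i + 1, by omega⟩) (j := ⟨j + 1, by omega⟩) (by simp; omega)]
  abel

/-- for odd `n`, the trace on all of `𝒞ₙ` of left multiplication
by `P = (ξ₁ − ξ₂) ⋯ (ξ_{n−1} − ξₙ)` is `(−1)^((n−1)/2) · 2ⁿ`
(equivalently, the coefficient of `1` in `P` is `(−1)^((n−1)/2)`). -/
theorem trace_mulLeft_Pelt (n : ℕ) (hn : 1 ≤ n) (hodd : Odd n) :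
    LinearMap.trace ℂ (Cl n) (LinearMap.mulLeft ℂ (Pelt n)) =
      (-1 : ℂ) ^ ((n - 1) / 2) * 2 ^ n := by
  obtain ⟨m, rfl⟩ := hodd
  rw [Pelt_eq, show 2 * m + 1 - 1 = 2 * m by omega, Nat.mul_div_cancel_left m two_pos]
  have h := tracial_prod_range' (R := ℂ) (LinearMap.trace ℂ (Cl (2 * m + 1)) ∘ₗ LinearMap.mul ℂ _)
    trace_mulLeft_mul_comm (ξdiff (2 * m + 1)) (2 * m) (ξdiff_adjacent (2 * m + 1))
    (ξdiff_anticommute (2 * m + 1)) m 0 (by omega)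
  have h1 : LinearMap.trace ℂ (Cl (2 * m + 1)) (LinearMap.mulLeft ℂ 1) = 2 ^ (2 * m + 1) := by
    rw [LinearMap.mulLeft_one, LinearMap.trace_id, finrank_Cl]
    simp
  exact h.trans (congrArg ((-1) ^ m * ·) h1)

end CliffordSpin
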